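/- For every integer i with 0 ≤ i < n: if t is odd, then a^{cⁱ(ba)^{(t-1)/2} b} = a^{c^{(n-1-i) mod n}(ba)^{(t-1)/2}}; if t is even, then a^{cⁱ(ba)^{(t-2)/2} b a} = a^{c^{(n-1-i) mod n}(ba)^{(t-2)/2} b}. (In the Cayley graph of Q_{(2,2,n)}(L_{2t}), with x_{i,2j} := a^{cⁱ(ba)^j} and x_{i,2j+1} := a^{cⁱ(ba)^j b}, this says x_{i,t-1}^{a(b)} = x_{n-1-i,t-1}, where a(b) is a if t is even and b if t is odd, first subscripts taken modulo n.) -/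

import Mathlib

/-- A quandle in the paper's (right-action) conventions: `op x y` is `x ▷ y` (written `x^y`)
and `inv x y` is `x ▷⁻¹ y` (written `x^{ȳ}`). -/
structure LinkQuandle (Q : Type*) where
  op : Q → Q → Q
  inv : Q → Q → Q
  idem : ∀ x, op x x = x
  inv_op : ∀ x y, inv (op x y) y = x
  op_inv : ∀ x y, op (inv x y) y = x
  distrib : ∀ x y z, op (op x y) z = op (op x z) (op y z)

/-- `opPow q y n x` is `x^{yⁿ}`: act on `x` by `y`, `n` times. -/
def LinkQuandle.opPow {Q : Type*} (q : LinkQuandle Q) (y : Q) (n : ℕ) (x : Q) : Q :=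
  (fun z => q.op z y)^[n] x

/-- `pairPow q y z t x` is `x^{(yz)^t}`: act on `x` by `y` then `z`, `t` times. -/
def LinkQuandle.pairPow {Q : Type*} (q : LinkQuandle Q) (y z : Q) (t : ℕ) (x : Q) : Q :=
  (fun w => q.op (q.op w y) z)^[t] x

/-- The smallest subset of `Q` containing `S` and closed under acting (and inversely acting)
by every element of `S`. -/
def LinkQuandle.genClosure {Q : Type*} (q : LinkQuandle Q) (S : Set Q) : Set Q :=
  ⋂₀ {T : Set Q | S ⊆ T ∧ ∀ x ∈ T, ∀ s ∈ S, q.op x s ∈ T ∧ q.inv x s ∈ T}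

section Group

variable {G : Type*} [Group G] {a b c r : G}

theorem commute_conj_of_commute_mul (hr : r * r = 1) (ha : a * a = 1)
    (hconj : r * c * r = a * c * a) (hcomm : Commute (c * r) a) :
    Commute c (r * c * r) := by
  have ha' : a⁻¹ = a := inv_eq_of_mul_eq_one_right ha
  have hr' : r⁻¹ = r := inv_eq_of_mul_eq_one_right hr
  have h : (c * r) * (a * c * a) * (c * r)⁻¹ = c := by
    rw [← hconj, mul_inv_rev, hr']
    calc c * r * (r * c * r) * (r * c⁻¹) = c * (r * r) * c * (r * r) * c⁻¹ := by group
      _ = c := by rw [hr]; group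
  have h' : (c * r) * (a * c * a) * (c * r)⁻¹ = a * ((c * r) * c * (c * r)⁻¹) * a := by
    have e : a * (c * r)⁻¹ = (c * r)⁻¹ * a := hcomm.inv_left.eq.symm
    calc (c * r) * (a * c * a) * (c * r)⁻¹ = ((c * r) * a) * c * (a * (c * r)⁻¹) := by group
      _ = (a * (c * r)) * c * ((c * r)⁻¹ * a) := by rw [hcomm.eq, e]
      _ = _ := by group
  have h'' : (c * r) * c * (c * r)⁻¹ = r * c * r := by
    calc (c * r) * c * (c * r)⁻¹ = a * a * ((c * r) * c * (c * r)⁻¹) * (a * a) := by simp [ha]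
      _ = a * (a * ((c * r) * c * (c * r)⁻¹) * a) * a := by group
      _ = r * c * r := by rw [← h', h, hconj]
  rw [mul_inv_rev, hr'] at h''
  calc c * (r * c * r) = (c * r * c * (r * c⁻¹)) * c := by group
    _ = _ := by rw [h'']

theorem pow_mul_mul_pow_eq_pow (hr : r * r = 1) (hcomm : Commute c (r * c * r)) (i : ℕ) :
    c ^ i * (c * r) * c ^ i = (c * r) ^ (2 * i + 1) := by
  have hc : Commute c ((c * r) ^ 2) := by
    rw [pow_two, show c * r * (c * r) = c * (r * c * r) by group]
    exact (Commute.refl c).mul_right hcomm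
  have hstep : c * (c * r) * c = (c * r) ^ 3 := by
    calc c * (c * r) * c = c * (c * (r * c * r)) * r⁻¹ := by group
      _ = c * ((r * c * r) * c) * r⁻¹ := by rw [hcomm.eq]
      _ = (c * r) ^ 2 * c * r⁻¹ := by rw [pow_two]; group
      _ = (c * r) ^ 3 := by rw [inv_eq_of_mul_eq_one_right hr, pow_succ _ 2, mul_assoc]
  induction i with
  | zero => simp
  | succ i ih =>
    calc c ^ (i + 1) * (c * r) * c ^ (i + 1)
        = c * (c ^ i * (c * r) * c ^ i) * c := by
          nth_rewrite 1 [pow_succ']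
          rw [pow_succ]
          group
      _ = c * (((c * r) ^ 2) ^ i * (c * r)) * c := by rw [ih, pow_succ, pow_mul]
      _ = ((c * r) ^ 2) ^ i * (c * (c * r) * c) := by
        rw [← mul_assoc c, (hc.pow_right i).eq]; group
      _ = _ := by rw [hstep, ← pow_mul, ← pow_add]; congr 1

theorem mul_mul_pow_comm_of_involutive (ha : a * a = 1) (hb : b * b = 1) (k : ℕ) :
    b * (a * b) ^ k = ((a * b) ^ k)⁻¹ * b := by
  rw [← inv_pow]
  refine SemiconjBy.pow_right (a := b) (x := a * b) (y := (a * b)⁻¹) ?_ k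
  rw [SemiconjBy, mul_inv_rev, inv_eq_of_mul_eq_one_right ha, inv_eq_of_mul_eq_one_right hb,
    mul_assoc]

theorem pow_mul_reflection_mul_pow (ha : a * a = 1) (hb : b * b = 1)
    (hc : Commute c (a * b)) (k : ℕ) (hcomm : Commute (c * (b * (a * b) ^ k)) a) (i : ℕ) :
    c ^ i * (c * (b * (a * b) ^ k)) * c ^ i = (c * (b * (a * b) ^ k)) ^ (2 * i + 1) := by
  have ha' : a⁻¹ = a := inv_eq_of_mul_eq_one_right ha
  have hb' : b⁻¹ = b := inv_eq_of_mul_eq_one_right hb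
  have hr : (b * (a * b) ^ k) * (b * (a * b) ^ k) = 1 := by
    nth_rewrite 1 [mul_mul_pow_comm_of_involutive ha hb]
    rw [mul_assoc, ← mul_assoc b b, hb]
    group
  refine pow_mul_mul_pow_eq_pow hr (commute_conj_of_commute_mul hr ha ?_ hcomm) i
  calc b * (a * b) ^ k * c * (b * (a * b) ^ k)
      = b * c * (a * b) ^ k * (b * (a * b) ^ k) := by
        rw [mul_assoc b _ c, ← (hc.pow_right k).eq, mul_assoc b c]
    _ = b * c * b := by rw [mul_mul_pow_comm_of_involutive ha hb]; group
    _ = a⁻¹ * (a * b * c) * b := by group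
    _ = a⁻¹ * c * a * (b * b) := by rw [← hc.eq]; group
    _ = a * c * a := by rw [hb, ha', mul_one]

end Group

namespace LinkQuandle

variable {Q : Type*} (q : LinkQuandle Q)

/-- The inner automorphism `x ↦ x ▷ y`. -/
def actPerm (y : Q) : Equiv.Perm Q where
  toFun x := q.op x y
  invFun x := q.inv x y
  left_inv x := q.inv_op x y
  right_inv x := q.op_inv x y

@[simp]
theorem actPerm_apply (x y : Q) : q.actPerm y x = q.op x y := rfl

/-- The permutations of `Q` preserving the quandle operation. -/
def homSubmonoid : Submonoid (Equiv.Perm Q) where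
  carrier := {g | ∀ x y, g (q.op x y) = q.op (g x) (g y)}
  one_mem' _ _ := rfl
  mul_mem' {g h} hg hh x y := by
    simp only [Set.mem_ofPred_eq] at hg hh
    simp [hg, hh]

theorem actPerm_mem_homSubmonoid (z : Q) : q.actPerm z ∈ q.homSubmonoid :=
  fun x y => q.distrib x y z

variable {q}

theorem commute_actPerm {g : Equiv.Perm Q} (hg : g ∈ q.homSubmonoid) {y : Q} (hy : g y = y) :
    Commute g (q.actPerm y) := by
  ext x
  simpa [hy] using hg x y

variable (q)

theorem opPow_eq (y : Q) (n : ℕ) (x : Q) : q.opPow y n x = (q.actPerm y ^ n) x := by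
  rw [Equiv.Perm.coe_pow]
  rfl

theorem pairPow_eq (y z : Q) (n : ℕ) (x : Q) :
    q.pairPow y z n x = ((q.actPerm z * q.actPerm y) ^ n) x := by
  rw [Equiv.Perm.coe_pow]
  rfl

end LinkQuandle


theorem stmt12 {Q : Type*} (q : LinkQuandle Q) (a b c : Q) (n t : ℕ)
    (hn : 2 ≤ n) (ht : 1 ≤ t)
    (h1 : q.op (q.op c a) b = c)
    (h2 : q.op (q.op (q.pairPow b a (t - 1) a) b) c = a)
    (h3 : q.op (q.pairPow a b t b) c = b)
    (ha : ∀ x : Q, q.op (q.op x a) a = x)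
    (hb : ∀ x : Q, q.op (q.op x b) b = x)
    (hc : ∀ x : Q, q.opPow c n x = x) :
    ∀ i : ℕ, i < n →
      (Odd t →
        q.op (q.pairPow b a ((t - 1) / 2) (q.opPow c i a)) b =
          q.pairPow b a ((t - 1) / 2) (q.opPow c ((n - 1 - i) % n) a)) ∧
      (Even t →
        q.op (q.op (q.pairPow b a ((t - 2) / 2) (q.opPow c i a)) b) a =
          q.op (q.pairPow b a ((t - 2) / 2) (q.opPow c ((n - 1 - i) % n) a)) b) := by
  intro i hi
  rw [Nat.mod_eq_of_lt (show n - 1 - i < n by omega)]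
  simp only [LinkQuandle.opPow_eq, LinkQuandle.pairPow_eq, ← LinkQuandle.actPerm_apply,
    ← Equiv.Perm.mul_apply] at *
  have mA := q.actPerm_mem_homSubmonoid a
  have mB := q.actPerm_mem_homSubmonoid b
  have mC := q.actPerm_mem_homSubmonoid c
  have hCc := fun g hg => LinkQuandle.commute_actPerm (q := q) (g := g) (y := c) hg
  have hCa := fun g hg => LinkQuandle.commute_actPerm (q := q) (g := g) (y := a) hg
  generalize q.actPerm a = A at *
  generalize q.actPerm b = B at *
  generalize q.actPerm c = C at *
  replace ha : A * A = 1 := Equiv.ext ha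
  replace hb : B * B = 1 := Equiv.ext hb
  replace hc : C ^ n = 1 := Equiv.ext hc
  have hA : A⁻¹ = A := inv_eq_of_mul_eq_one_right ha
  have hB : B⁻¹ = B := inv_eq_of_mul_eq_one_right hb
  have hCD : Commute C (A * B) := by
    have := (hCc _ (mul_mem mB mA) h1).inv_left.symm
    rwa [mul_inv_rev, hA, hB] at this
  have hfix : (C * (B * (A * B) ^ (t - 1))) a = a := h2
  have hCA := hCa _ (mul_mem mC (mul_mem mB (pow_mem (mul_mem mA mB) (t - 1)))) hfix
  have hmain : (C ^ (i + 1) * (B * (A * B) ^ (t - 1)) * C ^ i) a = a := by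
    rw [pow_succ, mul_assoc (C ^ i) C, pow_mul_reflection_mul_pow ha hb hCD _ hCA]
    exact (Function.IsFixedPt.perm_pow hfix _ :)
  have key (u v : Equiv.Perm Q) (huv : u⁻¹ * v = B * (A * B) ^ (t - 1)) :
      (v * C ^ i) a = (u * C ^ (n - 1 - i)) a := by
    have hn' : C ^ (n - 1 - i) = (C ^ (i + 1))⁻¹ := by
      rw [eq_inv_iff_mul_eq_one, ← pow_add, show n - 1 - i + (i + 1) = n by omega, hc]
    have e : v * C ^ i =
        u * (C ^ (i + 1))⁻¹ * (C ^ (i + 1) * (B * (A * B) ^ (t - 1)) * C ^ i) := by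
      rw [← huv]
      group
    rw [hn', e, Equiv.Perm.mul_apply, hmain]
  constructor
  · rintro ⟨s, rfl⟩
    rw [show (2 * s + 1 - 1) / 2 = s by omega]
    refine key ((A * B) ^ s) (B * (A * B) ^ s) ?_
    rw [← mul_assoc, ← mul_mul_pow_comm_of_involutive ha hb, mul_assoc, ← pow_add]
    congr 2
    omega
  · rintro ⟨s, rfl⟩
    rw [show (s + s - 2) / 2 = s - 1 by omega]
    refine key (B * (A * B) ^ (s - 1)) (A * (B * (A * B) ^ (s - 1))) ?_
    rw [mul_inv_rev, hB, mul_assoc, ← mul_assoc A, ← pow_succ', ← mul_assoc,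
      ← mul_mul_pow_comm_of_involutive ha hb, mul_assoc, ← pow_add]
    congr 2
    omega
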